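/- There is an explicit nonzero constant c depending only on the Fourier normalization such that for every t > 0 and every Schwartz function φ on ℝ, ∫_ℝ 𝒢_t[φ,φ,φ](ξ) · conj(φ̂(ξ)) dξ = c (2t)^{-1} ∭_{ℝ³} [e^{−iησ/(2t)} − 1] φ(z−η) φ(z−σ) φ̄(z) φ̄(z−η−σ) dz dη dσ. -/

import Mathlib

noncomputable section
open MeasureTheory Complex Real Filter Set ENNReal

/-- 1D Fourier transform with convention `(2π)^{-1/2} ∫ e^{-ixξ} f(x) dx`. -/
def ft (f : ℝ → ℂ) (ξ : ℝ) : ℂ :=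
  (((2 * π) ^ (-(1:ℝ)/2) : ℝ) : ℂ) * ∫ x : ℝ, Complex.exp (-(Complex.I * x * ξ)) * f x

/-- 1D inverse Fourier transform. -/
def ift (f : ℝ → ℂ) (x : ℝ) : ℂ :=
  (((2 * π) ^ (-(1:ℝ)/2) : ℝ) : ℂ) * ∫ ξ : ℝ, Complex.exp (Complex.I * x * ξ) * f ξ

/-- The Schrödinger group `e^{itΔ} f = 𝓕⁻¹ (e^{-itξ²} 𝓕 f)`. -/
def schrodinger (t : ℝ) (f : ℝ → ℂ) : ℝ → ℂ :=
  ift fun ξ => Complex.exp (-(Complex.I * t * ξ ^ 2)) * ft f ξ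

/-- Japanese bracket `⟨x⟩ = (1+x²)^{1/2}`. -/
def jb (x : ℝ) : ℝ := Real.sqrt (1 + x ^ 2)

/-- Inverse Fourier transform on `ℝ²` with convention `(2π)^{-1} ∫ e^{ip·q} G(q) dq`. -/
def ift2 (G : ℝ × ℝ → ℂ) (p : ℝ × ℝ) : ℂ :=
  (((2 * π)⁻¹ : ℝ) : ℂ) * ∫ q : ℝ × ℝ, Complex.exp (Complex.I * (p.1 * q.1 + p.2 * q.2)) * G q

/-- The trilinear kernel `G_ξ[f,g,h](η,σ) = f̂(ξ-η) (ḡ)^(η-ξ+σ) ĥ(ξ-σ)`. -/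
def Gker (f g h : ℝ → ℂ) (ξ : ℝ) (p : ℝ × ℝ) : ℂ :=
  ft f (ξ - p.1) * ft (fun x => (starRingEnd ℂ) (g x)) (p.1 - ξ + p.2) * ft h (ξ - p.2)

/-- The trilinear remainder `𝒢_t[f,g,h](ξ)`. -/
def calG (t : ℝ) (f g h : ℝ → ℂ) (ξ : ℝ) : ℂ :=
  (((2 * t)⁻¹ : ℝ) : ℂ) *
    ∫ p : ℝ × ℝ,
      (Complex.exp (-(Complex.I * p.1 * p.2 / (2 * t))) - 1) * ift2 (Gker f g h ξ) p

lemma two_pi_rpow_neg_half_mul_self :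
    (((2 * π) ^ (-(1:ℝ)/2) : ℝ) : ℂ) * (((2 * π) ^ (-(1:ℝ)/2) : ℝ) : ℂ) =
      (((2 * π)⁻¹ : ℝ) : ℂ) := by
  rw [← Complex.ofReal_mul, ← Real.rpow_add (by positivity), ← Real.rpow_neg_one]
  norm_num

lemma norm_exp_I_mul_ofReal_eq_one {z : ℂ} (x : ℝ) (hz : z = Complex.I * x) :
    ‖Complex.exp z‖ = 1 := by
  rw [hz, mul_comm, Complex.norm_exp_ofReal_mul_I]

open FourierTransform in
lemma ft_eq_fourier (f : SchwartzMap ℝ ℂ) (ξ : ℝ) :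
    ft f ξ = (((2 * π) ^ (-(1:ℝ)/2) : ℝ) : ℂ) * (𝓕 f : SchwartzMap ℝ ℂ) (ξ / (2 * π)) := by
  rw [ft, SchwartzMap.fourier_coe, Real.fourier_eq']
  congr 1
  refine integral_congr_ae (.of_forall fun x => ?_)
  simp only [smul_eq_mul, RCLike.inner_apply, conj_trivial]
  congr 2
  push_cast
  have : (π : ℂ) ≠ 0 := by exact_mod_cast Real.pi_ne_zero
  field_simp

lemma continuous_ft (f : SchwartzMap ℝ ℂ) : Continuous (ft f) := by
  rw [funext (ft_eq_fourier f)]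
  fun_prop

lemma integrable_ft (f : SchwartzMap ℝ ℂ) : Integrable (ft f) := by
  rw [funext (ft_eq_fourier f)]
  exact ((SchwartzMap.integrable _).comp_div (by positivity)).const_mul _

open FourierTransform in
/-- Fourier inversion for Schwartz functions. -/
lemma ift_ft (f : SchwartzMap ℝ ℂ) (x : ℝ) : ift (ft f) x = f x := by
  have hinv : (∫ w : ℝ, Complex.exp (Complex.I * x * (2 * π * w)) *
      (𝓕 f : SchwartzMap ℝ ℂ) w) = f x := by
    conv_rhs => rw [← FourierTransform.fourierInv_fourier_eq (F := SchwartzMap ℝ ℂ) f]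
    rw [SchwartzMap.fourierInv_coe, Real.fourierInv_eq']
    refine integral_congr_ae (.of_forall fun w => ?_)
    simp only [smul_eq_mul, RCLike.inner_apply, conj_trivial]
    congr 2
    push_cast
    ring
  have hscale := Measure.integral_comp_div
    (fun w : ℝ => Complex.exp (Complex.I * x * (2 * π * w)) * (𝓕 f : SchwartzMap ℝ ℂ) w) (2 * π)
  rw [hinv, abs_of_pos (by positivity), Complex.real_smul] at hscale
  have hpi : (π : ℂ) ≠ 0 := by exact_mod_cast Real.pi_ne_zero
  have hcongr : (∫ ξ : ℝ, Complex.exp (Complex.I * x * ξ) * ft f ξ) =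
      (((2 * π) ^ (-(1:ℝ)/2) : ℝ) : ℂ) * (((2 * π : ℝ) : ℂ) * f x) := by
    rw [← hscale, ← integral_const_mul]
    refine integral_congr_ae (.of_forall fun ξ => ?_)
    simp only [ft_eq_fourier]
    rw [show (2 * π * ((ξ / (2 * π) : ℝ) : ℂ) : ℂ) = ξ by push_cast; field_simp]
    ring
  rw [ift, hcongr, ← mul_assoc, two_pi_rpow_neg_half_mul_self]
  push_cast
  field_simp

lemma ift_ft_reflected (f : SchwartzMap ℝ ℂ) (ξ x : ℝ) :
    ift (fun η => ft f (ξ - η)) x = Complex.exp (Complex.I * x * ξ) * f (-x) := by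
  rw [← ift_ft f (-x), ift, ift, mul_left_comm,
    ← integral_const_mul (Complex.exp (Complex.I * x * ξ)),
    ← integral_sub_left_eq_self (fun η : ℝ => _ * (_ * ft f η)) volume ξ]
  congr 1
  refine integral_congr_ae (.of_forall fun η => ?_)
  simp only [← mul_assoc, ← Complex.exp_add]
  congr 2
  push_cast
  ring

lemma ift_conj_ft (f : SchwartzMap ℝ ℂ) (x : ℝ) :
    ift (fun ξ => (starRingEnd ℂ) (ft f ξ)) x = (starRingEnd ℂ) (f (-x)) := by
  rw [← ift_ft f (-x), ift, ift, map_mul, Complex.conj_ofReal, ← integral_conj]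
  congr 1
  refine integral_congr_ae (.of_forall fun ξ => ?_)
  simp only [map_mul, ← Complex.exp_conj, Complex.conj_I, Complex.conj_ofReal]
  congr 2
  push_cast
  ring

lemma integrable_conj_schwartz (f : SchwartzMap ℝ ℂ) :
    Integrable fun x => (starRingEnd ℂ) (f x) :=
  f.integrable.mono (by fun_prop) (.of_forall fun x => by simp)

/-- The inverse Fourier transform of the trilinear kernel in physical space. -/
lemma ift2_Gker (f g h : SchwartzMap ℝ ℂ) (ξ : ℝ) (p : ℝ × ℝ) :
    ift2 (Gker f g h ξ) p = (((2 * π) ^ (-(1:ℝ)/2) : ℝ) : ℂ) *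
      ∫ z : ℝ, Complex.exp (Complex.I * ((p.1 + p.2 - z : ℝ) : ℂ) * ξ) *
        ((starRingEnd ℂ) (g z) * f (z - p.1) * h (z - p.2)) := by
  obtain ⟨x, y⟩ := p
  have hint : Integrable (Function.uncurry fun (q : ℝ × ℝ) (z : ℝ) =>
      Complex.exp (Complex.I *
          ((x * q.1 + y * q.2 - z * (q.1 - ξ + q.2) : ℝ) : ℂ)) *
        (ft f (ξ - q.1) * ft h (ξ - q.2) * (starRingEnd ℂ) (g z)))
      ((volume : Measure (ℝ × ℝ)).prod (volume : Measure ℝ)) := by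
    refine Integrable.bdd_mul (c := 1) ?_ (by fun_prop)
      (.of_forall fun w => (norm_exp_I_mul_ofReal_eq_one _ rfl).le)
    exact (((integrable_ft f).comp_sub_left ξ).mul_prod
      ((integrable_ft h).comp_sub_left ξ)).mul_prod (integrable_conj_schwartz g)
  have hexpand : ∀ q : ℝ × ℝ,
      Complex.exp (Complex.I * (x * q.1 + y * q.2)) * Gker f g h ξ q =
        (((2 * π) ^ (-(1:ℝ)/2) : ℝ) : ℂ) * ∫ z : ℝ, Complex.exp (Complex.I *
          ((x * q.1 + y * q.2 - z * (q.1 - ξ + q.2) : ℝ) : ℂ)) *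
        (ft f (ξ - q.1) * ft h (ξ - q.2) * (starRingEnd ℂ) (g z)) := by
    intro q
    rw [Gker, ft.eq_1 (fun x => (starRingEnd ℂ) (g x))]
    have : ∀ a b c d e : ℂ, a * (b * (c * d) * e) = c * ((a * b * e) * d) := by intros; ring
    rw [this, ← integral_const_mul]
    congr 1
    refine integral_congr_ae (.of_forall fun z => ?_)
    have hexp : Complex.exp (Complex.I *
          ((x * q.1 + y * q.2 - z * (q.1 - ξ + q.2) : ℝ) : ℂ)) =
        Complex.exp (Complex.I * (x * q.1 + y * q.2)) *
          Complex.exp (-(Complex.I * z * ((q.1 - ξ + q.2 : ℝ) : ℂ))) := by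
      rw [← Complex.exp_add]
      congr 1
      push_cast
      ring
    simp only [hexp]
    ring
  rw [ift2]
  simp only [hexpand]
  rw [integral_const_mul, mul_left_comm, integral_integral_swap hint, ← integral_const_mul]
  congr 1
  refine integral_congr_ae (.of_forall fun z => ?_)
  have hf := ift_ft_reflected f ξ (x - z)
  have hh := ift_ft_reflected h ξ (y - z)
  rw [neg_sub] at hf hh
  have hprod : (∫ q : ℝ × ℝ, Complex.exp (Complex.I *
          ((x * q.1 + y * q.2 - z * (q.1 - ξ + q.2) : ℝ) : ℂ)) *
        (ft f (ξ - q.1) * ft h (ξ - q.2) * (starRingEnd ℂ) (g z))) =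
      Complex.exp (Complex.I * z * ξ) * (starRingEnd ℂ) (g z) *
      ((∫ η : ℝ, Complex.exp (Complex.I * ((x - z : ℝ) : ℂ) * η) * ft f (ξ - η)) *
        ∫ σ : ℝ, Complex.exp (Complex.I * ((y - z : ℝ) : ℂ) * σ) * ft h (ξ - σ)) := by
    rw [← integral_prod_mul, ← integral_const_mul]
    refine integral_congr_ae (.of_forall fun q => ?_)
    have hexp : Complex.exp (Complex.I *
          ((x * q.1 + y * q.2 - z * (q.1 - ξ + q.2) : ℝ) : ℂ)) =
        Complex.exp (Complex.I * z * ξ) * (Complex.exp (Complex.I * ((x - z : ℝ) : ℂ) * q.1) *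
          Complex.exp (Complex.I * ((y - z : ℝ) : ℂ) * q.2)) := by
      rw [← Complex.exp_add, ← Complex.exp_add]
      congr 1
      push_cast
      ring
    simp only [hexp]
    ring
  have hexp : Complex.exp (Complex.I * ((x + y - z : ℝ) : ℂ) * ξ) =
      Complex.exp (Complex.I * z * ξ) * (Complex.exp (Complex.I * ((x - z : ℝ) : ℂ) * ξ) *
        Complex.exp (Complex.I * ((y - z : ℝ) : ℂ) * ξ)) := by
    rw [← Complex.exp_add, ← Complex.exp_add]
    congr 1
    push_cast
    ring
  simp only [ift] at hf hh
  simp only [hprod, hexp, ← two_pi_rpow_neg_half_mul_self]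
  calc _ = Complex.exp (Complex.I * z * ξ) * (starRingEnd ℂ) (g z) *
      (((((2 * π) ^ (-(1:ℝ)/2) : ℝ) : ℂ) *
        ∫ η : ℝ, Complex.exp (Complex.I * ((x - z : ℝ) : ℂ) * η) * ft f (ξ - η)) *
      ((((2 * π) ^ (-(1:ℝ)/2) : ℝ) : ℂ) *
        ∫ σ : ℝ, Complex.exp (Complex.I * ((y - z : ℝ) : ℂ) * σ) * ft h (ξ - σ))) := by ring
    _ = _ := by
      rw [hf, hh]
      ring

lemma integrable_trilinear (f g h : SchwartzMap ℝ ℂ) :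
    Integrable (fun w : (ℝ × ℝ) × ℝ =>
      (starRingEnd ℂ) (g w.2) * f (w.2 - w.1.1) * h (w.2 - w.1.2)) := by
  have hcont : Continuous (fun w : (ℝ × ℝ) × ℝ =>
      (starRingEnd ℂ) (g w.2) * f (w.2 - w.1.1) * h (w.2 - w.1.2)) := by fun_prop
  rw [Measure.volume_eq_prod]
  refine (integrable_prod_iff' hcont.aestronglyMeasurable).2 ⟨.of_forall fun z => ?_, ?_⟩
  · simp only [mul_assoc]
    exact ((f.integrable.comp_sub_left z).mul_prod (h.integrable.comp_sub_left z)).const_mul _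
  · have : ∀ z : ℝ, (∫ p : ℝ × ℝ,
        ‖(starRingEnd ℂ) (g z) * f (z - p.1) * h (z - p.2)‖) =
        ‖g z‖ * ((∫ x, ‖f x‖) * ∫ x, ‖h x‖) := by
      intro z
      simp only [norm_mul, RCLike.norm_conj, mul_assoc]
      rw [integral_const_mul, Measure.volume_eq_prod,
        integral_prod_mul (fun x => ‖f (z - x)‖) (fun y => ‖h (z - y)‖),
        integral_sub_left_eq_self (fun x => ‖f x‖), integral_sub_left_eq_self (fun x => ‖h x‖)]
    simp only [this]
    exact g.integrable.norm.mul_const _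

lemma norm_phase_sub_one_le (t : ℝ) (p : ℝ × ℝ) :
    ‖Complex.exp (-(Complex.I * p.1 * p.2 / (2 * t))) - 1‖ ≤ 2 := by
  refine (norm_sub_le _ _).trans ?_
  rw [norm_exp_I_mul_ofReal_eq_one (-(p.1 * p.2 / (2 * t))) (by push_cast; ring), norm_one]
  norm_num

lemma integrable_phase_trilinear (t : ℝ) (f g h : SchwartzMap ℝ ℂ) :
    Integrable (fun w : (ℝ × ℝ) × ℝ =>
      (Complex.exp (-(Complex.I * w.1.1 * w.1.2 / (2 * t))) - 1) *
        ((starRingEnd ℂ) (g w.2) * f (w.2 - w.1.1) * h (w.2 - w.1.2))) :=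
  (integrable_trilinear f g h).bdd_mul (c := 2)
    (Continuous.aestronglyMeasurable (by fun_prop)) (.of_forall fun w => norm_phase_sub_one_le t w.1)

lemma calG_eq_integral (t : ℝ) (f g h : SchwartzMap ℝ ℂ) (ξ : ℝ) :
    calG t f g h ξ = (((2 * t)⁻¹ : ℝ) : ℂ) * ((((2 * π) ^ (-(1:ℝ)/2) : ℝ) : ℂ) *
      ∫ w : (ℝ × ℝ) × ℝ,
        Complex.exp (Complex.I * ((w.1.1 + w.1.2 - w.2 : ℝ) : ℂ) * ξ) *
        ((Complex.exp (-(Complex.I * w.1.1 * w.1.2 / (2 * t))) - 1) *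
          ((starRingEnd ℂ) (g w.2) * f (w.2 - w.1.1) * h (w.2 - w.1.2)))) := by
  have hint : Integrable (fun w : (ℝ × ℝ) × ℝ =>
      Complex.exp (Complex.I * ((w.1.1 + w.1.2 - w.2 : ℝ) : ℂ) * ξ) *
        ((Complex.exp (-(Complex.I * w.1.1 * w.1.2 / (2 * t))) - 1) *
          ((starRingEnd ℂ) (g w.2) * f (w.2 - w.1.1) * h (w.2 - w.1.2)))) :=
    (integrable_phase_trilinear t f g h).bdd_mul (c := 1)
      (Continuous.aestronglyMeasurable (by fun_prop))
      (.of_forall fun w => (norm_exp_I_mul_ofReal_eq_one ((w.1.1 + w.1.2 - w.2) * ξ)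
        (by push_cast; ring)).le)
  rw [calG, Measure.volume_eq_prod (ℝ × ℝ) ℝ, integral_prod _ hint,
    ← integral_const_mul (((2 * π) ^ (-(1:ℝ)/2) : ℝ) : ℂ)]
  congr 1
  refine integral_congr_ae (.of_forall fun p : ℝ × ℝ => ?_)
  simp only [ift2_Gker]
  rw [mul_left_comm, ← integral_const_mul]
  congr 1
  refine integral_congr_ae (.of_forall fun z => ?_)
  simp only
  ring

lemma integral_calG_mul_conj_ft (t : ℝ) (f g h k : SchwartzMap ℝ ℂ) :
    (∫ ξ : ℝ, calG t f g h ξ * (starRingEnd ℂ) (ft k ξ)) =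
      (((2 * t)⁻¹ : ℝ) : ℂ) * ∫ w : (ℝ × ℝ) × ℝ,
        (Complex.exp (-(Complex.I * w.1.1 * w.1.2 / (2 * t))) - 1) *
          ((starRingEnd ℂ) (g w.2) * f (w.2 - w.1.1) * h (w.2 - w.1.2)) *
            (starRingEnd ℂ) (k (w.2 - w.1.1 - w.1.2)) := by
  have hconj : Integrable fun ξ => (starRingEnd ℂ) (ft k ξ) :=
    (integrable_ft k).mono
      (Complex.continuous_conj.comp (continuous_ft k)).aestronglyMeasurable
      (.of_forall fun x => by simp)
  have hint : Integrable (Function.uncurry fun (ξ : ℝ) (w : (ℝ × ℝ) × ℝ) =>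
      Complex.exp (Complex.I * ((w.1.1 + w.1.2 - w.2 : ℝ) : ℂ) * ξ) *
      ((starRingEnd ℂ) (ft k ξ) *
        ((Complex.exp (-(Complex.I * w.1.1 * w.1.2 / (2 * t))) - 1) *
          ((starRingEnd ℂ) (g w.2) * f (w.2 - w.1.1) * h (w.2 - w.1.2)))))
      ((volume : Measure ℝ).prod volume) :=
    (hconj.mul_prod (integrable_phase_trilinear t f g h)).bdd_mul (c := 1)
      (Continuous.aestronglyMeasurable (by fun_prop))
      (.of_forall fun v => (norm_exp_I_mul_ofReal_eq_one
        ((v.2.1.1 + v.2.1.2 - v.2.2) * v.1) (by push_cast; ring)).le)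
  simp only [calG_eq_integral, mul_assoc (((2 * t)⁻¹ : ℝ) : ℂ),
    mul_assoc (((2 * π) ^ (-(1:ℝ)/2) : ℝ) : ℂ), ← integral_mul_const]
  rw [integral_const_mul, integral_const_mul]
  congr 1
  have hrearrange : ∀ a b c : ℂ, a * b * c = a * (c * b) := by intros; ring
  simp only [hrearrange (Complex.exp (Complex.I * _ * _)) _ ((starRingEnd ℂ) (ft k _))]
  rw [integral_integral_swap hint, ← integral_const_mul]
  refine integral_congr_ae (.of_forall fun w => ?_)
  have hk := ift_conj_ft k (w.1.1 + w.1.2 - w.2)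
  rw [ift, show -(w.1.1 + w.1.2 - w.2) = w.2 - w.1.1 - w.1.2 by ring] at hk
  simp only [← hk, ← mul_assoc (Complex.exp (Complex.I * _ * _)), integral_mul_const]
  ring

/-- pairing of `𝒢_t[φ,φ,φ]` with `φ̂` as an explicit multilinear integral. -/
theorem calG_pairing_identity :
    ∃ c : ℂ, c ≠ 0 ∧
      ∀ t : ℝ, 0 < t →
        ∀ φ : SchwartzMap ℝ ℂ,
          (∫ ξ : ℝ, calG t ⇑φ ⇑φ ⇑φ ξ * (starRingEnd ℂ) (ft ⇑φ ξ)) =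
            c * (((2 * t)⁻¹ : ℝ) : ℂ) *
              ∫ η : ℝ, ∫ σ : ℝ, ∫ z : ℝ,
                (Complex.exp (-(Complex.I * η * σ / (2 * t))) - 1) *
                  φ (z - η) * φ (z - σ) * (starRingEnd ℂ) (φ z) *
                    (starRingEnd ℂ) (φ (z - η - σ)) := by
  refine ⟨1, one_ne_zero, fun t _ φ => ?_⟩
  rw [integral_calG_mul_conj_ft, one_mul]
  congr 1
  have hint : Integrable (fun w : (ℝ × ℝ) × ℝ =>
      (Complex.exp (-(Complex.I * w.1.1 * w.1.2 / (2 * t))) - 1) *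
        ((starRingEnd ℂ) (φ w.2) * φ (w.2 - w.1.1) * φ (w.2 - w.1.2)) *
          (starRingEnd ℂ) (φ (w.2 - w.1.1 - w.1.2))) := by
    refine (integrable_phase_trilinear t φ φ φ).mul_bdd (c := ‖φ.toBoundedContinuousFunction‖)
      (Continuous.aestronglyMeasurable (by fun_prop)) (.of_forall fun w => ?_)
    rw [RCLike.norm_conj]
    exact φ.toBoundedContinuousFunction.norm_coe_le_norm _
  rw [Measure.volume_eq_prod (ℝ × ℝ) ℝ] at hint ⊢
  have hint_left := hint.integral_prod_left
  rw [integral_prod _ hint]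
  rw [Measure.volume_eq_prod ℝ ℝ] at hint_left ⊢
  rw [integral_prod _ hint_left]
  congr! 6
  ring
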